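/- Let r, d ≥ 1, let A ∈ ℝ_{≥0}^{r×d} be such that P = { x ∈ ℝ^d : x ≥ 0, Ax ≥ 𝟙_r } is nonempty (𝟙_r the all-ones vector in ℝ^r), and let w ∈ ℝ^d be a weight vector. Then ( min_{x∈P} ‖x‖_(w) ) · ( min_{λ∈Δ_r} ‖Aᵀλ‖*_(w) ) = 1, where Δ_r = { λ ∈ ℝ_{≥0}^r : Σ_i λ_i = 1 }; moreover, both minima are attained, and for any minimizers x* ∈ P and λ* ∈ Δ_r there exists a permutation π of {1,…,d} such that x*_{π(1)} ≥ x*_{π(2)} ≥ … ≥ x*_{π(d)} and (Aᵀλ*)_{π(1)} ≥ (Aᵀλ*)_{π(2)} ≥ … ≥ (Aᵀλ*)_{π(d)}. -/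

import Mathlib

/-- The vector of absolute values of the coordinates of `x`, sorted in decreasing order. -/
noncomputable def absSortDesc {d : ℕ} (x : Fin d → ℝ) : Fin d → ℝ :=
  fun k => |x (Tuple.sort (fun i => |x i|) k.rev)|

/-- The ordered norm `‖x‖_(w) = Σ_k w_k (|x|↓)_k`. -/
noncomputable def orderedNorm {d : ℕ} (w x : Fin d → ℝ) : ℝ :=
  ∑ k, w k * absSortDesc x k

/-- The top-`k` norm: the sum of the `k` largest coordinates of `|x|`. -/
noncomputable def topkNorm {d : ℕ} (k : ℕ) (x : Fin d → ℝ) : ℝ :=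
  ∑ i ∈ Finset.univ.filter (fun i : Fin d => (i : ℕ) < k), absSortDesc x i

/-- A weight vector: nonincreasing, nonnegative, nonzero. -/
def IsWeightVector {d : ℕ} (w : Fin d → ℝ) : Prop :=
  Antitone w ∧ (∀ k, 0 ≤ w k) ∧ w ≠ 0

/-- A symmetric monotonic norm on `ι → ℝ`. -/
def IsSymMonotoneNorm {ι : Type*} [Fintype ι] (f : (ι → ℝ) → ℝ) : Prop :=
  (∀ x, f x = 0 ↔ x = 0) ∧
  (∀ (a : ℝ) (x : ι → ℝ), f (a • x) = |a| * f x) ∧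
  (∀ x y : ι → ℝ, f (x + y) ≤ f x + f y) ∧
  (∀ (σ : Equiv.Perm ι) (x : ι → ℝ), f (x ∘ σ) = f x) ∧
  (∀ x y : ι → ℝ, (∀ i, 0 ≤ x i) → (∀ i, x i ≤ y i) → f x ≤ f y)

/-- Feasible load vectors of the Machine-Loads-Identical-Jobs problem. -/
def MLIJ {d : ℕ} (p : Fin d → ℝ) (n : ℕ) : Set (Fin d → ℝ) :=
  { x | ∃ m : Fin d → ℕ, (∑ i, m i) = n ∧ ∀ i, x i = (m i : ℝ) * p i }

/-- The dual of the ordered norm. -/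
noncomputable def dualOrderedNorm {d : ℕ} (w y : Fin d → ℝ) : ℝ :=
  sSup { r : ℝ | ∃ x : Fin d → ℝ, orderedNorm w x ≤ 1 ∧ r = ∑ i, y i * x i }

/-- The coordinates of `x` sorted in increasing order. -/
noncomputable def sortAsc {n : ℕ} (x : Fin n → ℝ) : Fin n → ℝ :=
  fun k => x (Tuple.sort x k)

/-- Distance vector induced by a set of open facilities. -/
noncomputable def distVec {X : Type*} [MetricSpace X] (F : Finset X) : X → ℝ :=
  fun j => sInf ((fun c => dist j c) '' (F : Set X))

/-- `x(l)`: the vector with the first `l+1` coordinates (indices `≤ l`) equal to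
`n / Σ_{j ≤ l} 1/p_j` and zero elsewhere. -/
noncomputable def vertexX {d : ℕ} (p : Fin d → ℝ) (n : ℝ) (l : Fin d) : Fin d → ℝ :=
  fun i => if i ≤ l then n / (∑ j ∈ Finset.univ.filter (fun j : Fin d => j ≤ l), 1 / p j) else 0

/-- Completion time of job `j` when job `j'` is assigned to machine `a j'` and jobs are
processed on each machine in the order induced by the priority permutation `π`. -/
noncomputable def completionTime {n d : ℕ} (p : Fin d → Fin n → ℝ)
    (a : Fin n → Fin d) (π : Equiv.Perm (Fin n)) : Fin n → ℝ :=
  fun j => ∑ j' ∈ Finset.univ.filter (fun j' : Fin n => a j' = a j ∧ π j' ≤ π j), p (a j) j'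

/-- A tour on `n` vertices starting at `v₀`: `τ 0 = v₀` and `τ` is a bijection from
`{0, …, n-1}` onto the vertex set. -/
def IsTour {V : Type*} (n : ℕ) (v₀ : V) (τ : ℕ → V) : Prop :=
  τ 0 = v₀ ∧ Set.BijOn τ (Set.Iio n) Set.univ

/-- The visit times of the vertices `τ 0, …, τ (n-1)` of a tour. -/
noncomputable def tourVisitTimes {V : Type*} [MetricSpace V] (n : ℕ) (τ : ℕ → V) : Fin n → ℝ :=
  fun i => ∑ j ∈ Finset.range (i : ℕ), dist (τ j) (τ (j + 1))

/-- Cover time of element `e` under the ordering `π` of the subsets `S 0, …, S (m-1)`: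
the position (in `{1, …, m}`) of the first subset containing `e`. -/
noncomputable def coverTime {n m : ℕ} (S : Fin m → Finset (Fin n))
    (π : Equiv.Perm (Fin m)) (e : Fin n) : ℕ :=
  1 + sInf {t : ℕ | ∃ h : t < m, e ∈ S (π ⟨t, h⟩)}

lemma antitone_absSortDesc {d : ℕ} (x : Fin d → ℝ) : Antitone (absSortDesc x) :=
  fun _ _ h => Tuple.monotone_sort (fun i => |x i|) (Fin.rev_le_rev.mpr h)

lemma exists_perm_orderedNorm_eq {d : ℕ} (w x : Fin d → ℝ) :
    ∃ σ : Equiv.Perm (Fin d), orderedNorm w x = ∑ k, w k * |x (σ k)| :=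
  ⟨Fin.revPerm.trans (Tuple.sort fun i => |x i|), rfl⟩

lemma sum_perm_le_orderedNorm {d : ℕ} {w : Fin d → ℝ} (hw : Antitone w) (x : Fin d → ℝ)
    (σ : Equiv.Perm (Fin d)) : ∑ k, w k * |x (σ k)| ≤ orderedNorm w x := by
  set τ : Equiv.Perm (Fin d) := Fin.revPerm.trans (Tuple.sort fun i => |x i|)
  have h : Monovary w (absSortDesc x) := hw.monovary (antitone_absSortDesc x)
  have key := h.sum_mul_comp_perm_le_sum_mul (σ := σ.trans τ.symm)
  have e : ∀ k, absSortDesc x ((σ.trans τ.symm) k) = |x (σ k)| := by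
    intro k
    change |x (τ (τ.symm (σ k)))| = _
    rw [Equiv.apply_symm_apply]
  simp only [e] at key
  exact key

lemma orderedNorm_le_iff {d : ℕ} {w : Fin d → ℝ} (hw : Antitone w) {x : Fin d → ℝ} {c : ℝ} :
    orderedNorm w x ≤ c ↔ ∀ σ : Equiv.Perm (Fin d), ∑ k, w k * |x (σ k)| ≤ c := by
  refine ⟨fun h σ => (sum_perm_le_orderedNorm hw x σ).trans h, fun h => ?_⟩
  obtain ⟨σ, hσ⟩ := exists_perm_orderedNorm_eq w x
  exact hσ ▸ h σ

lemma orderedNorm_comp_perm {d : ℕ} {w : Fin d → ℝ} (hw : Antitone w) (x : Fin d → ℝ)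
    (σ : Equiv.Perm (Fin d)) : orderedNorm w (fun i => x (σ i)) = orderedNorm w x := by
  apply le_antisymm
  · exact (orderedNorm_le_iff hw).mpr fun τ => sum_perm_le_orderedNorm hw x (τ.trans σ)
  · refine (orderedNorm_le_iff hw).mpr fun τ => ?_
    simpa using sum_perm_le_orderedNorm hw (fun i => x (σ i)) (τ.trans σ.symm)

lemma orderedNorm_smul {d : ℕ} {w : Fin d → ℝ} (hw : Antitone w) {a : ℝ} (ha : 0 ≤ a)
    (x : Fin d → ℝ) : orderedNorm w (a • x) = a * orderedNorm w x := by
  have e : ∀ σ : Equiv.Perm (Fin d),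
      ∑ k, w k * |(a • x) (σ k)| = a * ∑ k, w k * |x (σ k)| := by
    intro σ
    rw [Finset.mul_sum]
    refine Finset.sum_congr rfl fun k _ => ?_
    rw [Pi.smul_apply, smul_eq_mul, abs_mul, abs_of_nonneg ha]
    ring
  apply le_antisymm
  · refine (orderedNorm_le_iff hw).mpr fun σ => ?_
    rw [e]
    exact mul_le_mul_of_nonneg_left (sum_perm_le_orderedNorm hw x σ) ha
  · obtain ⟨σ, hσ⟩ := exists_perm_orderedNorm_eq w x
    rw [hσ, ← e]
    exact sum_perm_le_orderedNorm hw _ σ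

lemma orderedNorm_add_le {d : ℕ} {w : Fin d → ℝ} (hw : Antitone w) (hw0 : ∀ k, 0 ≤ w k)
    (x y : Fin d → ℝ) : orderedNorm w (x + y) ≤ orderedNorm w x + orderedNorm w y := by
  refine (orderedNorm_le_iff hw).mpr fun σ => ?_
  refine le_trans ?_ (add_le_add (sum_perm_le_orderedNorm hw x σ) (sum_perm_le_orderedNorm hw y σ))
  rw [← Finset.sum_add_distrib]
  refine Finset.sum_le_sum fun k _ => ?_
  rw [← mul_add]
  exact mul_le_mul_of_nonneg_left (abs_add_le _ _) (hw0 k)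

lemma orderedNorm_abs {d : ℕ} (w x : Fin d → ℝ) :
    orderedNorm w (fun i => |x i|) = orderedNorm w x := by
  simp [orderedNorm, absSortDesc]

lemma continuous_orderedNorm {d : ℕ} {w : Fin d → ℝ} (hw : Antitone w) :
    Continuous (orderedNorm w) := by
  have e : orderedNorm w = fun x => Finset.univ.sup' Finset.univ_nonempty
      fun σ : Equiv.Perm (Fin d) => ∑ k, w k * |x (σ k)| := by
    funext x
    refine eq_of_forall_ge_iff fun c => ?_
    simp [orderedNorm_le_iff hw]
  rw [e]
  exact Continuous.finset_sup'_apply _ fun σ _ => by fun_prop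

lemma IsWeightVector.zero_pos {d : ℕ} [NeZero d] {w : Fin d → ℝ} (hw : IsWeightVector w) :
    0 < w 0 := by
  refine lt_of_le_of_ne (hw.2.1 0) fun h => hw.2.2 (funext fun k => ?_)
  exact le_antisymm ((hw.1 (Fin.zero_le k)).trans h.ge) (hw.2.1 k)

lemma IsWeightVector.mul_abs_le_orderedNorm {d : ℕ} [NeZero d] {w : Fin d → ℝ}
    (hw : IsWeightVector w) (x : Fin d → ℝ) (i : Fin d) : w 0 * |x i| ≤ orderedNorm w x := by
  refine le_trans ?_ (sum_perm_le_orderedNorm hw.1 x (Equiv.swap 0 i))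
  simpa using Finset.single_le_sum (f := fun k => w k * |x (Equiv.swap 0 i k)|)
    (fun k _ => mul_nonneg (hw.2.1 k) (abs_nonneg _)) (Finset.mem_univ 0)

lemma IsWeightVector.sum_mul_le_dualOrderedNorm {d : ℕ} [NeZero d] {w : Fin d → ℝ}
    (hw : IsWeightVector w) (y : Fin d → ℝ) {x : Fin d → ℝ} (hx : orderedNorm w x ≤ 1) :
    ∑ i, y i * x i ≤ dualOrderedNorm w y := by
  refine le_csSup ⟨∑ i, |y i| * (1 / w 0), ?_⟩ ⟨x, hx, rfl⟩
  rintro _ ⟨z, hz, rfl⟩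
  refine Finset.sum_le_sum fun i _ => (le_abs_self _).trans ?_
  rw [abs_mul]
  refine mul_le_mul_of_nonneg_left ?_ (abs_nonneg _)
  rw [le_div_iff₀ hw.zero_pos, mul_comm]
  exact (hw.mul_abs_le_orderedNorm z i).trans hz

lemma IsWeightVector.sum_mul_le_orderedNorm_mul_dualOrderedNorm {d : ℕ} [NeZero d]
    {w : Fin d → ℝ} (hw : IsWeightVector w) (y : Fin d → ℝ) {x : Fin d → ℝ}
    (hx : 0 < orderedNorm w x) :
    ∑ i, y i * x i ≤ orderedNorm w x * dualOrderedNorm w y := by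
  have h := hw.sum_mul_le_dualOrderedNorm y (x := (orderedNorm w x)⁻¹ • x) (by
    rw [orderedNorm_smul hw.1 (inv_nonneg.mpr hx.le), inv_mul_cancel₀ hx.ne'])
  have e : ∑ i, y i * ((orderedNorm w x)⁻¹ • x) i = (orderedNorm w x)⁻¹ * ∑ i, y i * x i := by
    rw [Finset.mul_sum]
    refine Finset.sum_congr rfl fun i _ => ?_
    rw [Pi.smul_apply, smul_eq_mul]
    ring
  rw [e, inv_mul_le_iff₀ hx] at h
  exact h

/-- The dual norm of a nonnegative vector is controlled by its values on nonnegative vectors. -/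
lemma dualOrderedNorm_le {d : ℕ} {w y : Fin d → ℝ} {c : ℝ} (hy : ∀ i, 0 ≤ y i)
    (h : ∀ x : Fin d → ℝ, (∀ i, 0 ≤ x i) → orderedNorm w x ≤ 1 → ∑ i, y i * x i ≤ c) :
    dualOrderedNorm w y ≤ c := by
  apply csSup_le
  · exact ⟨0, 0, by simp [orderedNorm, absSortDesc], by simp⟩
  · rintro _ ⟨x, hx, rfl⟩
    refine le_trans ?_ (h (fun i => |x i|) (fun i => abs_nonneg _) (by rwa [orderedNorm_abs]))
    exact Finset.sum_le_sum fun i _ => mul_le_mul_of_nonneg_left (le_abs_self _) (hy i)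

lemma Monovary.exists_perm_antitone {d : ℕ} {x y : Fin d → ℝ} (h : Monovary x y) :
    ∃ π : Equiv.Perm (Fin d), Antitone (fun t => x (π t)) ∧ Antitone (fun t => y (π t)) := by
  let f : Fin d → ℝ ×ₗ ℝ := fun i => toLex (x i, y i)
  have hf : ∀ {i j : Fin d}, i ≤ j → f (Tuple.sort f j.rev) ≤ f (Tuple.sort f i.rev) :=
    fun hij => Tuple.monotone_sort f (Fin.rev_le_rev.mpr hij)
  refine ⟨Fin.revPerm.trans (Tuple.sort f), fun i j hij => ?_, fun i j hij => ?_⟩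
  · rcases Prod.Lex.toLex_le_toLex.mp (hf hij) with h1 | h1
    · exact h1.le
    · exact h1.1.le
  · rcases Prod.Lex.toLex_le_toLex.mp (hf hij) with h1 | h1
    · by_contra h2
      exact absurd (h (not_le.mp h2)) (not_le.mpr h1)
    · exact h1.2

/-- Equality case of the rearrangement inequality. -/
lemma monovary_of_forall_sum_comp_perm_le {d : ℕ} {x y : Fin d → ℝ}
    (h : ∀ σ : Equiv.Perm (Fin d), ∑ i, y i * x (σ i) ≤ ∑ i, y i * x i) : Monovary x y := by
  intro i j hij
  by_contra hx
  rw [not_le] at hx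
  have hne : i ≠ j := fun e => by simp [e] at hij
  have hs := h (Equiv.swap i j)
  rw [← sub_nonneg, ← Finset.sum_sub_distrib,
    ← Finset.sum_subset (Finset.subset_univ {i, j}), Finset.sum_pair hne] at hs
  · simp only [Equiv.swap_apply_left, Equiv.swap_apply_right] at hs
    nlinarith [mul_pos (sub_pos.mpr hij) (sub_pos.mpr hx)]
  · intro k _ hk
    simp only [Finset.mem_insert, Finset.mem_singleton, not_or] at hk
    rw [Equiv.swap_apply_of_ne_of_ne hk.1 hk.2, sub_self]

lemma sum_mul_sum_comm {r d : ℕ} (A : Fin r → Fin d → ℝ) (l : Fin r → ℝ) (x : Fin d → ℝ) :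
    ∑ j, (∑ i, l i * A i j) * x j = ∑ i, l i * ∑ j, A i j * x j := by
  simp only [Finset.sum_mul, Finset.mul_sum, mul_assoc]
  exact Finset.sum_comm

/-- Strong duality: a lower bound `N` for the covering program yields a point of the simplex whose
dual norm is at most `N⁻¹`. -/
lemma exists_dual_of_forall_orderedNorm_ge {r d : ℕ} {A : Fin r → Fin d → ℝ}
    (hA : ∀ i j, 0 ≤ A i j) {w : Fin d → ℝ} (hw : IsWeightVector w) (hr : 1 ≤ r) {N : ℝ}
    (hN : 0 < N)
    (h : ∀ x : Fin d → ℝ, (∀ j, 0 ≤ x j) → (∀ i, 1 ≤ ∑ j, A i j * x j) → N ≤ orderedNorm w x) :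
    ∃ l : Fin r → ℝ, (∀ i, 0 ≤ l i) ∧ ∑ i, l i = 1 ∧
      dualOrderedNorm w (fun j => ∑ i, l i * A i j) ≤ N⁻¹ := by
  have : Nonempty (Fin r) := ⟨⟨0, hr⟩⟩
  let K : Set (Fin r → ℝ) :=
    {u | ∃ x : Fin d → ℝ, (∀ j, 0 ≤ x j) ∧ orderedNorm w x ≤ 1 ∧ ∀ i, u i = ∑ j, A i j * x j}
  let U : Set (Fin r → ℝ) := Set.univ.pi fun _ => Set.Ioi N⁻¹
  have hK : Convex ℝ K := by
    rintro u ⟨x, hx, hx1, hu⟩ v ⟨z, hz, hz1, hv⟩ a b ha hb hab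
    refine ⟨a • x + b • z, fun j => ?_, ?_, fun i => ?_⟩
    · exact add_nonneg (mul_nonneg ha (hx j)) (mul_nonneg hb (hz j))
    · refine (orderedNorm_add_le hw.1 hw.2.1 _ _).trans ?_
      rw [orderedNorm_smul hw.1 ha, orderedNorm_smul hw.1 hb]
      nlinarith
    · simp only [Pi.add_apply, Pi.smul_apply, smul_eq_mul, hu, hv, Finset.mul_sum,
        ← Finset.sum_add_distrib]
      exact Finset.sum_congr rfl fun j _ => by ring
  have hUc : Convex ℝ U := convex_pi fun _ _ => convex_Ioi _
  have hUo : IsOpen U := isOpen_set_pi Set.finite_univ fun _ _ => isOpen_Ioi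
  have hdisj : Disjoint U K := by
    rw [Set.disjoint_left]
    rintro u hu ⟨x, hx, hx1, hux⟩
    obtain ⟨i₀, hi₀⟩ := Finite.exists_min u
    have ht : N⁻¹ < u i₀ := hu i₀ trivial
    have ht0 : 0 < u i₀ := (inv_pos.mpr hN).trans ht
    have := h ((u i₀)⁻¹ • x) (fun j => mul_nonneg (inv_nonneg.mpr ht0.le) (hx j)) fun i => by
      have e : ∑ j, A i j * ((u i₀)⁻¹ • x) j = (u i₀)⁻¹ * u i := by
        rw [hux i, Finset.mul_sum]
        exact Finset.sum_congr rfl fun j _ => by rw [Pi.smul_apply, smul_eq_mul]; ring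
      rw [e, ← div_eq_inv_mul, le_div_iff₀ ht0, one_mul]
      exact hi₀ i
    rw [orderedNorm_smul hw.1 (inv_nonneg.mpr ht0.le)] at this
    have h1 : (u i₀)⁻¹ < N := inv_lt_of_inv_lt₀ hN ht
    nlinarith [inv_pos.mpr ht0]
  obtain ⟨f, c, hfU, hfK⟩ := geometric_hahn_banach_open hUc hUo hK hdisj
  let g : Fin r → ℝ := fun i => - f (Pi.single i 1)
  have hfg : ∀ u, f u = - ∑ i, g i * u i := by
    intro u
    conv_lhs => rw [← Finset.univ_sum_single u]
    rw [map_sum, ← Finset.sum_neg_distrib]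
    refine Finset.sum_congr rfl fun i _ => ?_
    have : (Pi.single i (u i) : Fin r → ℝ) = u i • Pi.single i 1 := by
      rw [← Pi.single_smul, smul_eq_mul, mul_one]
    rw [this, map_smul, smul_eq_mul]
    simp only [g]
    ring
  have hc : 0 ≤ -c := by
    have : (0 : Fin r → ℝ) ∈ K := ⟨0, by simp, by simp [orderedNorm, absSortDesc], by simp⟩
    have := hfK _ this
    rw [map_zero] at this
    linarith
  have hgU : ∀ u ∈ U, -c < ∑ i, g i * u i := fun u hu => by
    have := hfU u hu
    rw [hfg] at this
    linarith
  have hg : ∀ i, 0 ≤ g i := by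
    intro i
    by_contra hi
    rw [not_le] at hi
    set S := ∑ k, g k * (N⁻¹ + 1)
    have ht : 0 ≤ |S| / -g i := div_nonneg (abs_nonneg _) (by linarith)
    have := hgU (fun k => N⁻¹ + 1 + Pi.single (M := fun _ => ℝ) i (|S| / -g i) k) (by
      intro k _
      have : 0 ≤ Pi.single (M := fun _ => ℝ) i (|S| / -g i) k := by
        by_cases hk : k = i
        · subst hk; simpa using ht
        · simp [hk]
      simp only [Set.mem_Ioi]
      linarith)
    simp only [mul_add _ (N⁻¹ + 1), Finset.sum_add_distrib] at this
    have e : ∑ k, g k * Pi.single (M := fun _ => ℝ) i (|S| / -g i) k = -|S| := by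
      rw [Finset.sum_eq_single i (fun k _ hk => by simp [hk]) (by simp), Pi.single_eq_same]
      rw [div_neg, mul_neg, mul_div_cancel₀ _ hi.ne]
    rw [e] at this
    change _ < S + _ at this
    linarith [le_abs_self S]
  have hgs : 0 < ∑ i, g i := by
    have := hgU (fun _ => N⁻¹ + 1) (fun i _ => by simp)
    rw [← Finset.sum_mul] at this
    exact pos_of_mul_pos_left (hc.trans_lt this) (by positivity)
  have hcN : -c ≤ (∑ i, g i) * N⁻¹ := by
    refine le_of_forall_pos_lt_add fun ε hε => ?_
    have := hgU (fun _ => N⁻¹ + ε / ∑ i, g i) (fun i _ => by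
      simp only [Set.mem_Ioi]
      linarith [div_pos hε hgs])
    rw [← Finset.sum_mul, mul_add, mul_div_cancel₀ _ hgs.ne'] at this
    exact this
  refine ⟨fun i => g i / ∑ k, g k, fun i => div_nonneg (hg i) hgs.le, ?_, ?_⟩
  · rw [← Finset.sum_div, div_self hgs.ne']
  · refine dualOrderedNorm_le (fun j => Finset.sum_nonneg fun i _ =>
      mul_nonneg (div_nonneg (hg i) hgs.le) (hA i j)) fun x hx hx1 => ?_
    rw [sum_mul_sum_comm]
    have := hfK _ ⟨x, hx, hx1, fun i => rfl⟩
    rw [hfg] at this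
    simp only [div_mul_eq_mul_div]
    rw [← Finset.sum_div, div_le_iff₀ hgs]
    linarith

lemma IsWeightVector.exists_orderedNorm_le_of_isClosed {d : ℕ} [NeZero d] {w : Fin d → ℝ}
    (hw : IsWeightVector w) {P : Set (Fin d → ℝ)} (hP : IsClosed P) (hne : P.Nonempty) :
    ∃ xs ∈ P, ∀ x ∈ P, orderedNorm w xs ≤ orderedNorm w x := by
  obtain ⟨x₀, hx₀⟩ := hne
  refine (continuous_orderedNorm hw.1).continuousOn.exists_isMinOn' hP hx₀ ?_
  set B := orderedNorm w x₀ / w 0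
  have hcomp : IsCompact (Metric.closedBall (0 : Fin d → ℝ) B) := isCompact_closedBall _ _
  refine Filter.mem_of_superset (Filter.mem_inf_of_left hcomp.compl_mem_cocompact) fun x hx => ?_
  by_contra hlt
  refine hx ?_
  have hB : 0 ≤ B := div_nonneg ((mul_nonneg hw.zero_pos.le (abs_nonneg (x₀ 0))).trans
    (hw.mul_abs_le_orderedNorm x₀ 0)) hw.zero_pos.le
  rw [mem_closedBall_zero_iff, pi_norm_le_iff_of_nonneg hB]
  intro i
  rw [Real.norm_eq_abs, le_div_iff₀ hw.zero_pos, mul_comm]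
  exact (hw.mul_abs_le_orderedNorm x i).trans (not_le.mp hlt).le

/-- Lemma (primal-dual counting): strong duality between the ordered-norm covering
program and its simplex dual, and order-consistency of minimizers. -/
theorem stmt19 (r d : ℕ) (hr : 1 ≤ r) (hd : 1 ≤ d)
    (A : Fin r → Fin d → ℝ) (hA : ∀ i j, 0 ≤ A i j)
    (w : Fin d → ℝ) (hw : IsWeightVector w)
    (P : Set (Fin d → ℝ))
    (hP : P = {x | (∀ j, 0 ≤ x j) ∧ ∀ i, 1 ≤ ∑ j, A i j * x j})
    (hPne : P.Nonempty)
    (Δr : Set (Fin r → ℝ))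
    (hΔr : Δr = {l | (∀ i, 0 ≤ l i) ∧ (∑ i, l i) = 1}) :
    (∃ xs ∈ P, ∀ x ∈ P, orderedNorm w xs ≤ orderedNorm w x) ∧
    (∃ ls ∈ Δr, ∀ l ∈ Δr,
      dualOrderedNorm w (fun j => ∑ i, ls i * A i j) ≤
        dualOrderedNorm w (fun j => ∑ i, l i * A i j)) ∧
    ∀ xs ∈ P, ∀ ls ∈ Δr,
      (∀ x ∈ P, orderedNorm w xs ≤ orderedNorm w x) →
      (∀ l ∈ Δr,
        dualOrderedNorm w (fun j => ∑ i, ls i * A i j) ≤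
          dualOrderedNorm w (fun j => ∑ i, l i * A i j)) →
      orderedNorm w xs * dualOrderedNorm w (fun j => ∑ i, ls i * A i j) = 1 ∧
      ∃ π : Equiv.Perm (Fin d),
        Antitone (fun t => xs (π t)) ∧
        Antitone (fun t => ∑ i, ls i * A i (π t)) := by
  have : NeZero d := ⟨by omega⟩
  subst hP hΔr
  have hclosed : IsClosed {x : Fin d → ℝ | (∀ j, 0 ≤ x j) ∧ ∀ i, 1 ≤ ∑ j, A i j * x j} := by
    simp only [Set.ofPred_and, Set.ofPred_forall]
    exact (isClosed_iInter fun j => isClosed_le continuous_const (by fun_prop)).inter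
      (isClosed_iInter fun i => isClosed_le continuous_const (by fun_prop))
  obtain ⟨x₀, hx₀, hmin⟩ := hw.exists_orderedNorm_le_of_isClosed hclosed hPne
  have hpos : ∀ x : Fin d → ℝ, (∀ i, 1 ≤ ∑ j, A i j * x j) → 0 < orderedNorm w x := by
    intro x hx
    by_contra hle
    have hx0 : ∀ j, x j = 0 := fun j => abs_nonpos_iff.mp <|
      nonpos_of_mul_nonpos_right ((hw.mul_abs_le_orderedNorm x j).trans (not_lt.mp hle)) hw.zero_pos
    have := hx ⟨0, hr⟩
    norm_num [hx0] at this
  have hpair : ∀ x : Fin d → ℝ, (∀ i, 1 ≤ ∑ j, A i j * x j) → ∀ l : Fin r → ℝ,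
      (∀ i, 0 ≤ l i) → ∑ i, l i = 1 → 1 ≤ ∑ j, (∑ i, l i * A i j) * x j := by
    intro x hx l hl hl1
    rw [sum_mul_sum_comm, ← hl1]
    exact Finset.sum_le_sum fun i _ => le_mul_of_one_le_right (hl i) (hx i)
  have hN := hpos x₀ hx₀.2
  obtain ⟨l₀, hl₀, hl₀1, hl₀N⟩ := exists_dual_of_forall_orderedNorm_ge hA hw hr hN
    fun x h1 h2 => hmin x ⟨h1, h2⟩
  refine ⟨⟨x₀, hx₀, hmin⟩, ⟨l₀, ⟨hl₀, hl₀1⟩, fun l hl => hl₀N.trans ?_⟩, ?_⟩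
  · rw [inv_le_iff_one_le_mul₀' hN]
    exact (hpair x₀ hx₀.2 l hl.1 hl.2).trans
      (hw.sum_mul_le_orderedNorm_mul_dualOrderedNorm _ hN)
  · intro xs hxs ls hls hxmin hlmin
    have hNs := hpos xs hxs.2
    have heq : orderedNorm w xs = orderedNorm w x₀ := le_antisymm (hxmin x₀ hx₀) (hmin xs hxs)
    have hle : orderedNorm w xs * dualOrderedNorm w (fun j => ∑ i, ls i * A i j) ≤ 1 := by
      rw [← le_inv_mul_iff₀ hNs, mul_one, heq]
      exact (hlmin l₀ ⟨hl₀, hl₀1⟩).trans hl₀N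
    have hge := hpair xs hxs.2 ls hls.1 hls.2
    refine ⟨le_antisymm hle
      (hge.trans (hw.sum_mul_le_orderedNorm_mul_dualOrderedNorm _ hNs)), ?_⟩
    refine Monovary.exists_perm_antitone (y := fun j => ∑ i, ls i * A i j)
      (monovary_of_forall_sum_comp_perm_le fun σ => le_trans ?_ hge)
    have hσ := orderedNorm_comp_perm hw.1 xs σ
    refine (hw.sum_mul_le_orderedNorm_mul_dualOrderedNorm _ (hσ ▸ hNs)).trans ?_
    rwa [hσ]
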